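/- Let a be a nonnegative element of the descent algebra Σ(W) and n ≥ 1. Then aⁿΣ(W) = aΣ(W) and Σ(W)aⁿ = Σ(W)a. -/

import Mathlib

open MonoidAlgebra

variable {B W : Type*} [DecidableEq B] [Fintype B] [Group W] [Fintype W] [DecidableEq W]

/-- `x_I`: the sum, in the group algebra `ℚW`, of the minimal length coset
representatives of the standard parabolic subgroup `W_I` in `W`, i.e. the sum of the
`w ∈ W` such that `ws > w` for all `s ∈ I`. -/
noncomputable def descentBasis {M : CoxeterMatrix B} (cs : CoxeterSystem M W)
    (I : Finset B) : MonoidAlgebra ℚ W :=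
  ∑ w : W, if ∀ i ∈ I, cs.length w < cs.length (w * cs.simple i)
    then MonoidAlgebra.single w (1 : ℚ) else 0

/-- `A` is the Solomon descent algebra `Σ(W)` of `(W,S)`: a subalgebra of the group
algebra `ℚW` whose underlying set is the span of the elements `x_I`, `I ⊆ S`.
(By Solomon's theorem this span is indeed closed under multiplication.) -/
def IsDescentAlgebra {M : CoxeterMatrix B} (cs : CoxeterSystem M W)
    (A : Subalgebra ℚ (MonoidAlgebra ℚ W)) : Prop :=
  (A : Set (MonoidAlgebra ℚ W)) = Submodule.span ℚ (Set.range (descentBasis cs))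

set_option linter.unusedSectionVars false

section LRB
variable {S : Type*} [Monoid S] [Fintype S] [DecidableEq S]

lemma lrb_coeff_mul (x y : MonoidAlgebra ℚ S) (s : S) :
    (x * y).coeff s = ∑ p : S, ∑ g : S, if p * g = s then x.coeff p * y.coeff g else 0 := by
  rw [MonoidAlgebra.coeff_mul]
  rw [Finsupp.sum_fintype _ _ (by intro i; simp [Finsupp.sum])]
  refine Finset.sum_congr rfl fun p _ => ?_
  rw [Finsupp.sum_fintype _ _ (by intro i; simp)]

/-- The eigenvalue attached to `s`. -/
def lrbEig (α : MonoidAlgebra ℚ S) (s : S) : ℚ := ∑ g : S, if s * g = s then α.coeff g else 0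

/-- The span of the elements with positive eigenvalue. -/
def lrbV (α : MonoidAlgebra ℚ S) : Submodule ℚ (MonoidAlgebra ℚ S) where
  carrier := {v | ∀ s, v.coeff s ≠ 0 → 0 < lrbEig α s}
  zero_mem' := by intro s h; simp at h
  add_mem' := by
    intro v w hv hw s h
    by_cases h1 : v.coeff s = 0
    · apply hw
      intro h2
      simp [h1, h2] at h
    · exact hv s h1
  smul_mem' := by
    intro c v hv s h
    apply hv
    intro h2
    apply h
    rw [MonoidAlgebra.coeff_smul_apply, h2, smul_zero]

lemma lrb_idem (hS : ∀ x y : S, x * y * x = x * y)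
    (x : S) : x * x = x := by simpa using hS x 1

lemma lrb_stab (hS : ∀ x y : S, x * y * x = x * y)
    {s g f : S} (h : s * f = s) : s * g * f = s * g := by
  calc s * g * f = s * f * g * f := by rw [h]
    _ = s * (f * g * f) := by simp only [mul_assoc]
    _ = s * f * g := by rw [hS, mul_assoc]
    _ = s * g := by rw [h]

lemma lrb_self_mem (hS : ∀ x y : S, x * y * x = x * y)
    {α : MonoidAlgebra ℚ S} (hα : ∀ s, 0 ≤ α.coeff s) : α ∈ lrbV α := by
  intro s hs
  refine Finset.sum_pos' (fun g _ => ?_) ⟨s, Finset.mem_univ _, ?_⟩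
  · split_ifs
    exacts [hα g, le_rfl]
  · rw [if_pos (lrb_idem hS s)]
    exact lt_of_le_of_ne (hα s) (Ne.symm hs)

lemma lrb_mul_mem (hS : ∀ x y : S, x * y * x = x * y)
    {α : MonoidAlgebra ℚ S} (hα : ∀ s, 0 ≤ α.coeff s) {v : MonoidAlgebra ℚ S}
    (hv : v ∈ lrbV α) : v * α ∈ lrbV α := by
  intro s hs
  rw [lrb_coeff_mul] at hs
  obtain ⟨p, -, hp⟩ := Finset.exists_ne_zero_of_sum_ne_zero hs
  obtain ⟨g, -, hg⟩ := Finset.exists_ne_zero_of_sum_ne_zero hp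
  split_ifs at hg with h
  · have h1 := hv p (left_ne_zero_of_mul hg)
    refine lt_of_lt_of_le h1 (Finset.sum_le_sum fun f _ => ?_)
    by_cases h2 : p * f = p
    · rw [if_pos h2, if_pos]
      rw [← h]
      exact lrb_stab hS h2
    · rw [if_neg h2]
      split_ifs
      exacts [hα f, le_rfl]
  · exact absurd rfl hg

lemma lrb_inj (hS : ∀ x y : S, x * y * x = x * y)
    {α : MonoidAlgebra ℚ S} {v : MonoidAlgebra ℚ S}
    (hv : v ∈ lrbV α) (h0 : v * α = 0) : v = 0 := by
  classical
  by_contra hne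
  let r : S → ℕ := fun s => (Finset.univ.filter fun f => s * f = s).card
  have hr : ∀ s g, s * g ≠ s → r s < r (s * g) := by
    intro s g hsg
    apply Finset.card_lt_card
    rw [Finset.ssubset_iff_of_subset]
    · refine ⟨g, ?_, ?_⟩
      · simp [mul_assoc, lrb_idem hS g]
      · simpa using hsg
    · intro f hf
      simp only [Finset.mem_filter, Finset.mem_univ, true_and] at hf ⊢
      exact lrb_stab hS hf
  have hnon : (Finset.univ.filter fun s => v.coeff s ≠ 0).Nonempty := by
    by_contra h
    rw [Finset.not_nonempty_iff_eq_empty] at h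
    apply hne
    ext s
    by_contra h2
    have : s ∈ (Finset.univ.filter fun s => v.coeff s ≠ 0) := by simpa using h2
    rw [h] at this
    simp at this
  obtain ⟨s, hs, hmin⟩ := Finset.exists_min_image _ r hnon
  simp only [Finset.mem_filter, Finset.mem_univ, true_and] at hs hmin
  have h1 : (v * α).coeff s = v.coeff s * lrbEig α s := by
    rw [lrb_coeff_mul, Finset.sum_eq_single s]
    · rw [lrbEig, Finset.mul_sum]
      refine Finset.sum_congr rfl fun g _ => ?_
      split_ifs <;> simp
    · intro p _ hps
      refine Finset.sum_eq_zero fun g _ => ?_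
      split_ifs with h
      · have : v.coeff p = 0 := by
          by_contra h3
          have h4 := hmin p h3
          have h5 := hr p g (by rw [h]; exact hps.symm)
          rw [h] at h5
          omega
        rw [this, zero_mul]
      · rfl
    · simp
  rw [h0] at h1
  have := hv s hs
  simp only [MonoidAlgebra.coeff_zero, Finsupp.coe_zero, Pi.zero_apply] at h1
  exact (mul_ne_zero hs this.ne') h1.symm

lemma lrb_aeval_mem (hS : ∀ x y : S, x * y * x = x * y)
    {α : MonoidAlgebra ℚ S} (hα : ∀ s, 0 ≤ α.coeff s) {v : MonoidAlgebra ℚ S}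
    (hv : v ∈ lrbV α) (p : Polynomial ℚ) : v * Polynomial.aeval α p ∈ lrbV α := by
  have hpow : ∀ k : ℕ, v * α ^ k ∈ lrbV α := by
    intro k
    induction k with
    | zero => simpa using hv
    | succ k ih =>
      rw [pow_succ, ← mul_assoc]
      exact lrb_mul_mem hS hα ih
  rw [Polynomial.aeval_eq_sum_range, Finset.mul_sum]
  refine Submodule.sum_mem _ fun k _ => ?_
  rw [mul_smul_comm]
  exact Submodule.smul_mem _ _ (hpow k)

lemma lrb_main (hS : ∀ x y : S, x * y * x = x * y)
    {α : MonoidAlgebra ℚ S} (hα : ∀ s, 0 ≤ α.coeff s) :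
    ∃ q : Polynomial ℚ, Polynomial.aeval α (Polynomial.X - Polynomial.X ^ 2 * q) = 0 := by
  have hfin : Module.Finite ℚ (MonoidAlgebra ℚ S) := inferInstance
  obtain ⟨p, hp, hpα⟩ := (Algebra.IsIntegral.isIntegral (R := ℚ) α)
  have hp0 := hp.ne_zero
  obtain ⟨g, hg, hndvd⟩ := Polynomial.exists_eq_pow_rootMultiplicity_mul_and_not_dvd p hp0 0
  rw [Polynomial.C_0, sub_zero] at hg hndvd
  rw [Polynomial.X_dvd_iff] at hndvd
  have hpα' : Polynomial.aeval α p = 0 := hpα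
  have key : ∀ k : ℕ, α ^ k * Polynomial.aeval α g = 0 → α * Polynomial.aeval α g = 0 := by
    intro k
    induction k with
    | zero =>
      intro h
      rw [pow_zero, one_mul] at h
      rw [h, mul_zero]
    | succ k ih =>
      intro h
      rcases k with _ | k
      · simpa using h
      · apply ih
        have hm : α * Polynomial.aeval α (Polynomial.X ^ k * g) ∈ lrbV α :=
          lrb_aeval_mem hS hα (lrb_self_mem hS hα) _
        have hcomm : Polynomial.aeval α g * α = α * Polynomial.aeval α g := by
          have := congrArg (Polynomial.aeval α) (mul_comm g Polynomial.X)
          simpa using this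
        have hz := lrb_inj hS hm (by
          rw [map_mul, map_pow, Polynomial.aeval_X]
          rw [← h]
          simp only [mul_assoc, hcomm]
          rw [pow_succ', pow_succ]
          simp only [mul_assoc])
        rw [map_mul, map_pow, Polynomial.aeval_X] at hz
        rw [pow_succ', mul_assoc]
        exact hz
  have hfinal : α * Polynomial.aeval α g = 0 := by
    apply key (Polynomial.rootMultiplicity 0 p)
    rw [hg] at hpα'
    simpa using hpα'
  refine ⟨-(Polynomial.C (g.coeff 0)⁻¹ * g.divX), ?_⟩
  have : (Polynomial.X - Polynomial.X ^ 2 * -(Polynomial.C (g.coeff 0)⁻¹ * g.divX) : Polynomial ℚ)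
      = Polynomial.C (g.coeff 0)⁻¹ * (Polynomial.X * g) := by
    have h2 := Polynomial.divX_mul_X_add g
    have h1 : (Polynomial.C (g.coeff 0)⁻¹ * Polynomial.C (g.coeff 0) : Polynomial ℚ) = 1 := by
      rw [← Polynomial.C_mul, inv_mul_cancel₀ hndvd, Polynomial.C_1]
    linear_combination (-Polynomial.X) * h1 + Polynomial.C (g.coeff 0)⁻¹ * Polynomial.X * h2
  rw [this, map_mul, map_mul, Polynomial.aeval_X, hfinal, mul_zero]

end LRB

namespace CoxSide
variable {B W : Type*} [Group W] [DecidableEq W] {M : CoxeterMatrix B} (cs : CoxeterSystem M W)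

/-- Action of a generator on `W × ZMod 2`. -/
def genAct (i : B) : Function.End (W × ZMod 2) := fun p =>
  (cs.simple i * p.1 * (cs.simple i)⁻¹, p.2 + if p.1 = cs.simple i then 1 else 0)

lemma genAct_pow (i j : B) (k : ℕ) (t : W) (e : ZMod 2) :
    ((genAct cs i * genAct cs j) ^ k) (t, e) =
      ((cs.simple i * cs.simple j) ^ k * t * ((cs.simple i * cs.simple j) ^ k)⁻¹,
        e + ∑ l ∈ Finset.range (2 * k),
          if t = (cs.simple j * cs.simple i) ^ l * cs.simple j then (1 : ZMod 2) else 0) := by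
  induction k with
  | zero => simp [Function.End.one_def]
  | succ k ih =>
    have hinv : (cs.simple i * cs.simple j)⁻¹ = cs.simple j * cs.simple i := by simp
    have hpj : ∀ l : ℕ, cs.simple j * (cs.simple i * cs.simple j) ^ l =
        (cs.simple j * cs.simple i) ^ l * cs.simple j := by
      intro l
      induction l with
      | zero => simp
      | succ l ihl =>
        rw [pow_succ, ← mul_assoc, ihl, pow_succ]
        simp only [mul_assoc]
    rw [pow_succ']
    change (genAct cs i * genAct cs j) (((genAct cs i * genAct cs j) ^ k) (t, e)) = _
    rw [ih]
    have e1 : (cs.simple i * cs.simple j) ^ k * t * ((cs.simple i * cs.simple j) ^ k)⁻¹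
        = cs.simple j ↔ t = (cs.simple j * cs.simple i) ^ (2 * k) * cs.simple j := by
      rw [mul_inv_eq_iff_eq_mul, hpj, ← eq_inv_mul_iff_mul_eq, ← inv_pow, hinv, two_mul, pow_add,
        mul_assoc]
    have e2 : cs.simple j * ((cs.simple i * cs.simple j) ^ k * t *
        ((cs.simple i * cs.simple j) ^ k)⁻¹) * (cs.simple j)⁻¹
        = cs.simple i ↔ t = (cs.simple j * cs.simple i) ^ (2 * k + 1) * cs.simple j := by
      rw [mul_inv_eq_iff_eq_mul, ← eq_inv_mul_iff_mul_eq, mul_inv_eq_iff_eq_mul,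
        ← eq_inv_mul_iff_mul_eq, ← inv_pow, hinv, cs.inv_simple]
      have : (cs.simple j * cs.simple i) ^ k * (cs.simple j * (cs.simple i * cs.simple j) *
          (cs.simple i * cs.simple j) ^ k) =
          (cs.simple j * cs.simple i) ^ (2 * k + 1) * cs.simple j := by
        rw [mul_assoc (cs.simple j), ← pow_succ', hpj, ← mul_assoc, ← pow_add]
        congr 2
        omega
      rw [this]
    rw [show 2 * (k + 1) = 2 * k + 1 + 1 by ring, Finset.sum_range_succ, Finset.sum_range_succ]
    change genAct cs i (genAct cs j (_, _)) = _
    simp only [genAct, e1, e2]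
    refine Prod.ext ?_ ?_
    · simp only [pow_succ' (cs.simple i * cs.simple j) k, mul_inv_rev, mul_assoc]
    · simp only [add_assoc]

lemma genAct_liftable : M.IsLiftable (genAct cs) := by
  intro i j
  funext ⟨t, e⟩
  rw [genAct_pow, cs.simple_mul_simple_pow]
  have h : ∑ l ∈ Finset.range (2 * M i j),
      (if t = (cs.simple j * cs.simple i) ^ l * cs.simple j then (1 : ZMod 2) else 0) = 0 := by
    rw [two_mul, Finset.sum_range_add]
    simp only [pow_add, cs.simple_mul_simple_pow', one_mul]
    exact CharTwo.add_self_eq_zero _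
  rw [h]
  simp [Function.End.one_def]

/-- The action of `W`. -/
def act : W →* Function.End (W × ZMod 2) := cs.lift ⟨genAct cs, genAct_liftable cs⟩

/-- The parity cocycle. -/
def par (w t : W) : ZMod 2 := (act cs w (t, 0)).2

lemma act_word (ω : List B) (t : W) (e : ZMod 2) :
    act cs (cs.wordProd ω) (t, e) = (cs.wordProd ω * t * (cs.wordProd ω)⁻¹,
      e + ((cs.rightInvSeq ω).count t : ZMod 2)) := by
  induction ω with
  | nil => simp [Function.End.one_def]
  | cons i ω ih =>
    rw [cs.wordProd_cons, map_mul]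
    change act cs (cs.simple i) (act cs (cs.wordProd ω) (t, e)) = _
    rw [ih, act, cs.lift_apply_simple]
    have e1 : cs.wordProd ω * t * (cs.wordProd ω)⁻¹ = cs.simple i ↔
        (cs.wordProd ω)⁻¹ * cs.simple i * cs.wordProd ω = t := by
      rw [mul_inv_eq_iff_eq_mul, ← eq_inv_mul_iff_mul_eq, eq_comm, mul_assoc]
    refine Prod.ext ?_ ?_
    · simp only [genAct, mul_inv_rev, mul_assoc]
    · simp only [genAct, CoxeterSystem.rightInvSeq, List.count_cons, e1, beq_iff_eq, add_assoc]
      push_cast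
      rfl

lemma act_apply (w t : W) (e : ZMod 2) : act cs w (t, e) = (w * t * w⁻¹, e + par cs w t) := by
  obtain ⟨ω, rfl⟩ := cs.wordProd_surjective w
  rw [par, act_word, act_word, zero_add]

lemma par_word (ω : List B) (t : W) :
    par cs (cs.wordProd ω) t = ((cs.rightInvSeq ω).count t : ZMod 2) := by
  rw [par, act_word, zero_add]

lemma par_mul (u v t : W) : par cs (u * v) t = par cs v t + par cs u (v * t * v⁻¹) := by
  have : act cs (u * v) (t, 0) = act cs u (act cs v (t, 0)) := by rw [map_mul]; rfl
  rw [par, this, act_apply, act_apply, zero_add]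

lemma par_one (t : W) : par cs 1 t = 0 := by
  simp [par, Function.End.one_def]

lemma par_simple (i : B) : par cs (cs.simple i) (cs.simple i) = 1 := by
  have := par_word cs [i] (cs.simple i)
  simpa using this

lemma par_simple_ne (i : B) {t : W} (h : t ≠ cs.simple i) : par cs (cs.simple i) t = 0 := by
  have := par_word cs [i] t
  simpa [List.count_singleton, h.symm] using this

lemma par_ne_zero {w t : W} (h : par cs w t ≠ 0) : cs.IsReflection t ∧
    cs.length (w * t) < cs.length w := by
  obtain ⟨ω, hω, rfl⟩ := cs.exists_isReduced w
  rw [par_word] at h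
  have : t ∈ cs.rightInvSeq ω := by
    by_contra h1
    rw [List.count_eq_zero_of_not_mem h1] at h
    simp at h
  exact cs.isRightInversion_of_mem_rightInvSeq hω this

lemma zmod2_cases (x : ZMod 2) : x = 0 ∨ x = 1 := by
  revert x; decide

lemma par_of_descent {w : W} {i : B} (h : cs.length (w * cs.simple i) < cs.length w) :
    par cs w (cs.simple i) = 1 := by
  rcases zmod2_cases (par cs w (cs.simple i)) with h0 | h1
  · have h2 : par cs (w * cs.simple i) (cs.simple i) = 1 := by
      rw [par_mul, par_simple]
      simp [h0]
    have h3 := (par_ne_zero cs (w := w * cs.simple i) (t := cs.simple i)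
      (by rw [h2]; decide)).2
    rw [cs.simple_mul_simple_cancel_right] at h3
    omega
  · exact h1

/-- The side vector. -/
def side (w t : W) : ZMod 2 := par cs w⁻¹ t

lemma side_mul (w v t : W) : side cs (w * v) t = side cs w t + side cs v (w⁻¹ * t * w) := by
  rw [side, mul_inv_rev, par_mul, inv_inv]; rfl

lemma side_injective : Function.Injective (side cs) := by
  intro w w' h
  have h1 : ∀ t, side cs (w⁻¹ * w') t = 0 := by
    intro t
    have := side_mul cs w (w⁻¹ * w') (w * t * w⁻¹)
    rw [mul_inv_cancel_left, h] at this
    have h2 : w⁻¹ * (w * t * w⁻¹) * w = t := by group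
    rw [h2] at this
    simpa using this
  by_contra hne
  have h3 : (w⁻¹ * w') ≠ 1 := by
    intro h4
    exact hne (inv_mul_eq_one.mp h4)
  obtain ⟨i, hi⟩ := cs.exists_rightDescent_of_ne_one (inv_ne_one.mpr h3)
  have h5 := par_of_descent cs hi
  have h6 := h1 (cs.simple i)
  rw [side, h5] at h6
  exact absurd h6 (by decide)

/-- standard parabolic subgroup -/
def parab (J : Finset B) : Subgroup W := Subgroup.closure (cs.simple '' (J : Set B))

lemma simple_mem (J : Finset B) {i : B} (hi : i ∈ J) : cs.simple i ∈ parab cs J :=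
  Subgroup.subset_closure ⟨i, hi, rfl⟩

lemma parab_word (J : Finset B) {y : W} (hy : y ∈ parab cs J) :
    ∃ ω : List B, (∀ i ∈ ω, i ∈ J) ∧ cs.wordProd ω = y := by
  induction hy using Subgroup.closure_induction with
  | mem x hx =>
    obtain ⟨i, hi, rfl⟩ := hx
    exact ⟨[i], by simpa using hi, by simp⟩
  | one => exact ⟨[], by simp, by simp⟩
  | mul x y _ _ hx hy =>
    obtain ⟨ω, h1, rfl⟩ := hx
    obtain ⟨ω', h1', rfl⟩ := hy
    refine ⟨ω ++ ω', ?_, cs.wordProd_append _ _⟩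
    intro i hi
    rcases List.mem_append.mp hi with h | h
    exacts [h1 i h, h1' i h]
  | inv x _ hx =>
    obtain ⟨ω, h1, rfl⟩ := hx
    exact ⟨ω.reverse, by simpa using h1, by simp⟩

lemma parab_descent_aux (J : Finset B) (k : ℕ) : ∀ ω : List B, ω.length ≤ k →
    (∀ i ∈ ω, i ∈ J) → cs.wordProd ω ≠ 1 → ∃ i ∈ J, par cs (cs.wordProd ω) (cs.simple i) = 1 := by
  induction k with
  | zero =>
    intro ω h _ hne
    have : ω = [] := List.length_eq_zero_iff.mp (by omega)
    subst this
    simp at hne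
  | succ k ih =>
    intro ω hlen hJ hne
    rcases List.eq_nil_or_concat ω with rfl | ⟨ω', i, rfl⟩
    · simp at hne
    rw [List.concat_eq_append] at hlen hJ hne ⊢
    have hiJ : i ∈ J := hJ i (by simp)
    rcases zmod2_cases (par cs (cs.wordProd (ω' ++ [i])) (cs.simple i)) with h0 | h1
    · have hmem : cs.simple i ∈ cs.rightInvSeq ω' := by
        by_contra hnot
        have : par cs (cs.wordProd ω') (cs.simple i) = 0 := by
          rw [par_word, List.count_eq_zero_of_not_mem hnot, Nat.cast_zero]
        rw [cs.wordProd_append, cs.wordProd_singleton, par_mul, par_simple] at h0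
        simp [this] at h0
      obtain ⟨j, hj, hj'⟩ := List.mem_iff_getElem.mp hmem
      have h3 := cs.wordProd_mul_getD_rightInvSeq ω' j
      rw [List.getD_eq_getElem _ 1 hj, hj'] at h3
      have h4 : cs.wordProd (ω' ++ [i]) = cs.wordProd (ω'.eraseIdx j) := by
        rw [cs.wordProd_append, cs.wordProd_singleton, h3]
      rw [h4] at hne ⊢
      apply ih _ _ _ hne
      · have := List.length_eraseIdx_le ω' j
        simp at hlen
        omega
      · intro l hl
        exact hJ l (List.mem_append_left _ (List.mem_of_mem_eraseIdx hl))
    · exact ⟨i, hiJ, h1⟩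

lemma parab_descent (J : Finset B) {y : W} (hy : y ∈ parab cs J) (hne : y ≠ 1) :
    ∃ i ∈ J, par cs y (cs.simple i) = 1 := by
  obtain ⟨ω, h1, rfl⟩ := parab_word cs J hy
  exact parab_descent_aux cs J _ ω le_rfl h1 hne

/-- Minimal coset representatives. -/
def IsMin (J : Finset B) (w : W) : Prop := ∀ i ∈ J, cs.length w < cs.length (w * cs.simple i)

lemma exists_min (J : Finset B) (w : W) : ∃ y ∈ parab cs J, IsMin cs J (w * y) ∧
    ∀ r ∈ parab cs J, par cs (w * y) r = 0 := by
  have hne : ∃ n, ∃ y ∈ parab cs J, cs.length (w * y) = n := ⟨_, 1, one_mem _, rfl⟩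
  classical
  obtain ⟨y, hy, hy'⟩ := Nat.find_spec hne
  have hmin : ∀ z ∈ parab cs J, cs.length (w * y) ≤ cs.length (w * y * z) := by
    intro z hz
    rw [hy']
    exact Nat.find_min' hne ⟨y * z, mul_mem hy hz, by rw [mul_assoc]⟩
  refine ⟨y, hy, ?_, ?_⟩
  · intro i hi
    exact lt_of_le_of_ne (hmin _ (simple_mem cs J hi)) (cs.length_mul_simple_ne _ _).symm
  · intro r hr
    by_contra h
    have := (par_ne_zero cs h).2
    have := hmin r hr
    omega

lemma min_unique (J : Finset B) {m y : W} (hm : ∀ r ∈ parab cs J, par cs m r = 0)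
    (hy : y ∈ parab cs J) (hmin : IsMin cs J (m * y)) : y = 1 := by
  by_contra hne
  obtain ⟨i, hi, h⟩ := parab_descent cs J hy hne
  have h1 : par cs (m * y) (cs.simple i) = 1 := by
    rw [par_mul, h, hm, add_zero]
    exact mul_mem (mul_mem hy (simple_mem cs J hi)) (inv_mem hy)
  have h2 := (par_ne_zero cs (w := m * y) (t := cs.simple i) (by rw [h1]; decide)).2
  have := hmin i hi
  omega

lemma min_par (J : Finset B) {v : W} (hv : IsMin cs J v) : ∀ r ∈ parab cs J, par cs v r = 0 := by
  obtain ⟨y, hy, h1, h2⟩ := exists_min cs J v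
  have := min_unique cs J h2 (inv_mem hy) (by simpa using hv)
  rw [inv_eq_one] at this
  subst this
  simpa using h2

lemma rep_bijective (J : Finset B) :
    Function.Bijective (fun v : {v : W // IsMin cs J v} => (v.1 : W ⧸ parab cs J)) := by
  constructor
  · rintro ⟨v, hv⟩ ⟨v', hv'⟩ h
    have h1 : v⁻¹ * v' ∈ parab cs J := QuotientGroup.eq.mp h
    have := min_unique cs J (min_par cs J hv) h1 (by simpa using hv')
    exact Subtype.ext (inv_mul_eq_one.mp this)
  · intro F
    obtain ⟨w, rfl⟩ := QuotientGroup.mk_surjective F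
    obtain ⟨y, hy, h1, -⟩ := exists_min cs J w
    refine ⟨⟨w * y, h1⟩, ?_⟩
    refine (QuotientGroup.eq.mpr ?_).symm
    simpa using hy

/-- representative equivalence -/
noncomputable def rep (J : Finset B) : {v : W // IsMin cs J v} ≃ W ⧸ parab cs J :=
  Equiv.ofBijective _ (rep_bijective cs J)

/-- Sides are constant on a coset outside the stabiliser. -/
lemma side_coset (J : Finset B) (m t : W) (ht : m⁻¹ * t * m ∉ parab cs J) {y : W}
    (hy : y ∈ parab cs J) : side cs (m * y) t = side cs m t := by
  rw [side_mul]
  suffices h : side cs y (m⁻¹ * t * m) = 0 by rw [h, add_zero]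
  generalize m⁻¹ * t * m = r at ht
  obtain ⟨ω, h1, rfl⟩ := parab_word cs J hy
  clear hy
  induction ω generalizing r with
  | nil => simp [side, par_one]
  | cons i ω ih =>
    have hi := simple_mem cs J (h1 i (by simp))
    rw [cs.wordProd_cons, side_mul, ih, add_zero, side, cs.inv_simple]
    · apply par_simple_ne
      rintro rfl
      exact ht hi
    · intro h
      apply ht
      have := mul_mem (mul_mem hi h) (inv_mem hi)
      convert this using 1
      group
    · intro j hj
      exact h1 j (by simp [hj])

/-- The sign vector. -/
noncomputable def sgn (J : Finset B) (F : W ⧸ parab cs J) : W → Option (ZMod 2) := by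
  classical
  exact fun t => if ((rep cs J).symm F).1⁻¹ * t * ((rep cs J).symm F).1 ∈ parab cs J then none
    else some (side cs ((rep cs J).symm F).1 t)

lemma sgn_mul (J : Finset B) (F : W ⧸ parab cs J) (w t : W) :
    side cs (w * ((rep cs J).symm (w⁻¹ • F)).1) t = (sgn cs J F t).getD (side cs w t) := by
  classical
  set m := ((rep cs J).symm F) with hm
  set v := ((rep cs J).symm (w⁻¹ • F)) with hv
  have hmF : (m.1 : W ⧸ parab cs J) = F := (rep cs J).apply_symm_apply F
  have hvF : (v.1 : W ⧸ parab cs J) = w⁻¹ • F := (rep cs J).apply_symm_apply _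
  have hrel : m.1⁻¹ * (w * v.1) ∈ parab cs J := by
    apply QuotientGroup.eq.mp
    rw [hmF]
    have : ((w * v.1 : W) : W ⧸ parab cs J) = w • (v.1 : W ⧸ parab cs J) := rfl
    rw [this, hvF, smul_inv_smul]
  simp only [sgn, ← hm]
  split_ifs with h
  · rw [Option.getD_none, side_mul]
    suffices h : side cs v.1 (w⁻¹ * t * w) = 0 by rw [h, add_zero]
    have h1 := par_mul cs v.1 v.1⁻¹ (w⁻¹ * t * w)
    rw [mul_inv_cancel, par_one, min_par cs J v.2, add_zero] at h1
    · exact h1.symm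
    · have := mul_mem (mul_mem (inv_mem hrel) h) hrel
      convert this using 1
      group
  · rw [Option.getD_some]
    have := side_coset cs J m.1 t h hrel
    rwa [mul_inv_cancel_left] at this

end CoxSide

/-- Sign vectors. -/
def SignVec (W : Type*) : Type _ := W → Option (ZMod 2)

namespace SignVec
variable {T : Type*}

noncomputable instance [Fintype T] : Fintype (SignVec T) := by
  classical
  exact inferInstanceAs (Fintype (T → Option (ZMod 2)))

noncomputable instance : DecidableEq (SignVec T) := Classical.decEq _

/-- Composition of sign vectors. -/
def comp (x y : SignVec T) : SignVec T := fun t => (x t).or (y t)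

instance : Monoid (SignVec T) where
  mul := comp
  one := fun _ => none
  mul_assoc x y z := by
    funext t
    exact Option.or_assoc
  one_mul x := by
    funext t
    exact Option.none_or
  mul_one x := by
    funext t
    exact Option.or_none

lemma mul_apply (x y : SignVec T) (t : T) : (x * y) t = (x t).or (y t) := rfl

lemma lrb (x y : SignVec T) : x * y * x = x * y := by
  funext t
  rw [mul_apply, mul_apply]
  cases x t <;> cases y t <;> rfl

end SignVec

namespace CoxSide
variable {B W : Type*} [Group W] [DecidableEq W] {M : CoxeterMatrix B} (cs : CoxeterSystem M W)

/-- Chambers as sign vectors. -/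
def chamber (w : W) : SignVec W := fun t => some (side cs w t)

lemma chamber_injective : Function.Injective (chamber cs) := by
  intro w w' h
  apply side_injective cs
  funext t
  exact Option.some_injective _ (congrFun h t)

/-- The sign vector of a face, as an element of the monoid of sign vectors. -/
noncomputable def face (J : Finset B) (F : W ⧸ parab cs J) : SignVec W := sgn cs J F

lemma sgn_mul_chamber (J : Finset B) (F : W ⧸ parab cs J) (w : W) :
    face cs J F * chamber cs w =
      chamber cs (w * ((rep cs J).symm (w⁻¹ • F)).1) := by
  funext t
  rw [SignVec.mul_apply]
  simp only [chamber, sgn_mul, face]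
  cases sgn cs J F t <;> rfl

end CoxSide

section Final
open CoxSide
open scoped Classical in
lemma descentBasis_eq {M : CoxeterMatrix B} (cs : CoxeterSystem M W) (J : Finset B) :
    descentBasis cs J = ∑ v : {v : W // IsMin cs J v}, MonoidAlgebra.single v.1 (1 : ℚ) := by
  rw [descentBasis, ← Finset.sum_filter]
  symm
  refine Finset.sum_bij' (fun v _ => v.1) (fun v hv => ⟨v, by simpa [CoxSide.IsMin] using hv⟩) ?_ ?_ ?_ ?_ ?_
  · intro v _
    simpa [CoxSide.IsMin] using v.2
  all_goals simp

open scoped Classical in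
/-- The lift of `x_J` to the algebra of sign vectors. -/
noncomputable def liftBasis {M : CoxeterMatrix B} (cs : CoxeterSystem M W) (J : Finset B) :
    MonoidAlgebra ℚ (SignVec W) :=
  ∑ F : W ⧸ parab cs J, MonoidAlgebra.single (face cs J F) (1 : ℚ)

lemma liftBasis_mul {M : CoxeterMatrix B} (cs : CoxeterSystem M W) (J : Finset B) (w : W) :
    liftBasis cs J * MonoidAlgebra.single (chamber cs w) 1 =
      MonoidAlgebra.mapDomainLinearMap ℚ ℚ (chamber cs)
        (MonoidAlgebra.single w 1 * descentBasis cs J) := by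
  classical
  rw [descentBasis_eq, liftBasis, Finset.sum_mul, Finset.mul_sum, map_sum]
  simp only [MonoidAlgebra.single_mul_single, sgn_mul_chamber, mul_one,
    MonoidAlgebra.mapDomainLinearMap_single]
  exact Fintype.sum_equiv ((MulAction.toPerm w⁻¹).trans (rep cs J).symm) _ _ (fun F => rfl)

lemma lift_mul {M : CoxeterMatrix B} (cs : CoxeterSystem M W) (c : Finset B → ℚ)
    (x : MonoidAlgebra ℚ W) :
    (∑ J : Finset B, c J • liftBasis cs J) *
        MonoidAlgebra.mapDomainLinearMap ℚ ℚ (chamber cs) x =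
      MonoidAlgebra.mapDomainLinearMap ℚ ℚ (chamber cs)
        (x * ∑ J : Finset B, c J • descentBasis cs J) := by
  induction x using MonoidAlgebra.induction_linear with
  | zero => simp
  | add x y hx hy => rw [map_add, mul_add, hx, hy, add_mul, map_add]
  | single w r =>
    have : (MonoidAlgebra.single w r : MonoidAlgebra ℚ W) = r • MonoidAlgebra.single w 1 := by
      simp
    rw [this, map_smul, mul_smul_comm, smul_mul_assoc, map_smul]
    congr 1
    rw [MonoidAlgebra.mapDomainLinearMap_single, Finset.sum_mul, Finset.mul_sum, map_sum]
    refine Finset.sum_congr rfl fun J _ => ?_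
    rw [smul_mul_assoc, liftBasis_mul, mul_smul_comm, map_smul]

lemma exists_poly {M : CoxeterMatrix B} (cs : CoxeterSystem M W) (c : Finset B → ℚ)
    (hc : ∀ I, 0 ≤ c I) (a : MonoidAlgebra ℚ W)
    (ha : a = ∑ I : Finset B, c I • descentBasis cs I) :
    ∃ q : Polynomial ℚ, a = a ^ 2 * Polynomial.aeval a q := by
  classical
  set α : MonoidAlgebra ℚ (SignVec W) := ∑ J : Finset B, c J • liftBasis cs J with hαdef
  set L := MonoidAlgebra.mapDomainLinearMap ℚ ℚ (chamber cs) with hL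
  have hLinj : Function.Injective L := MonoidAlgebra.mapDomain_injective (chamber_injective cs)
  have hmul : ∀ x, α * L x = L (x * a) := by
    intro x
    rw [ha]
    exact lift_mul cs c x
  have hα : ∀ s, 0 ≤ α.coeff s := by
    intro s
    simp only [hαdef, liftBasis, MonoidAlgebra.coeff_sum, Finsupp.finsetSum_apply,
      MonoidAlgebra.coeff_smul_apply, MonoidAlgebra.coeff_single]
    refine Finset.sum_nonneg fun J _ => ?_
    refine smul_nonneg (hc J) (Finset.sum_nonneg fun F _ => ?_)
    rw [Finsupp.single_apply]
    split_ifs <;> norm_num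
  obtain ⟨q, hq⟩ := lrb_main SignVec.lrb hα
  have hpow : ∀ (k : ℕ) x, α ^ k * L x = L (x * a ^ k) := by
    intro k
    induction k with
    | zero => intro x; simp
    | succ k ih =>
      intro x
      rw [pow_succ, mul_assoc, hmul, ih, pow_succ', mul_assoc]
  have hpoly : ∀ (p : Polynomial ℚ) x, Polynomial.aeval α p * L x =
      L (x * Polynomial.aeval a p) := by
    intro p x
    rw [Polynomial.aeval_eq_sum_range, Polynomial.aeval_eq_sum_range, Finset.sum_mul,
      Finset.mul_sum, map_sum]
    refine Finset.sum_congr rfl fun k _ => ?_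
    rw [smul_mul_assoc, hpow, mul_smul_comm, map_smul]
  have h0 := hpoly (Polynomial.X - Polynomial.X ^ 2 * q) 1
  rw [hq, zero_mul, one_mul] at h0
  have h1 := hLinj (h0.symm.trans (map_zero L).symm)
  refine ⟨q, ?_⟩
  rw [map_sub, map_mul, map_pow, Polynomial.aeval_X] at h1
  exact sub_eq_zero.mp h1
end Final

set_option synthInstance.maxHeartbeats 1000000 in
set_option maxHeartbeats 1000000 in
/-- For a nonnegative element `a` of the descent algebra and `n ≥ 1`, one has
`aⁿΣ(W) = aΣ(W)` and `Σ(W)aⁿ = Σ(W)a`. -/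
theorem pos_element_power_ideals {M : CoxeterMatrix B}
    (cs : CoxeterSystem M W) (A : Subalgebra ℚ (MonoidAlgebra ℚ W))
    (hA : IsDescentAlgebra cs A) (a : MonoidAlgebra ℚ W) (c : Finset B → ℚ)
    (hc : ∀ I, 0 ≤ c I) (ha : a = ∑ I : Finset B, c I • descentBasis cs I)
    (n : ℕ) (hn : 1 ≤ n) :
    ({x : MonoidAlgebra ℚ W | ∃ b ∈ A, x = a ^ n * b} =
      {x : MonoidAlgebra ℚ W | ∃ b ∈ A, x = a * b}) ∧
    ({x : MonoidAlgebra ℚ W | ∃ b ∈ A, x = b * a ^ n} =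
      {x : MonoidAlgebra ℚ W | ∃ b ∈ A, x = b * a}) := by
  obtain ⟨q, hq⟩ := exists_poly cs c hc a ha
  have haA : a ∈ A := by
    have : a ∈ (A : Set (MonoidAlgebra ℚ W)) := by
      rw [hA, ha]
      exact Submodule.sum_mem _ fun I _ =>
        Submodule.smul_mem _ _ (Submodule.subset_span ⟨I, rfl⟩)
    exact this
  have hqA : Polynomial.aeval a q ∈ A := by
    have h1 := Polynomial.aeval_mem_adjoin_singleton ℚ a (p := q)
    exact (Algebra.adjoin_le (by simpa using haA)) h1
  have hcomm : Commute a (Polynomial.aeval a q) := by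
    have h2 := congrArg (Polynomial.aeval a) (mul_comm Polynomial.X q)
    rw [map_mul, map_mul, Polynomial.aeval_X] at h2
    exact h2
  generalize Polynomial.aeval a q = r at hq hqA hcomm
  obtain ⟨m, rfl⟩ : ∃ m, n = m + 1 := ⟨n - 1, by omega⟩
  have hpow : ∀ m : ℕ, a = a ^ (m + 1) * r ^ m := by
    intro m
    induction m with
    | zero => simp
    | succ m ih =>
      have h3 : a ^ (m + 1 + 1) * r ^ (m + 1) = a ^ m * (a ^ 2 * r) * r ^ m := by
        rw [show m + 1 + 1 = m + 2 by ring, pow_add, pow_succ' r]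
        simp only [mul_assoc]
      rw [h3, ← hq, ← pow_succ]
      exact ih
  have hrm : r ^ m ∈ A := pow_mem hqA m
  have ham : a ^ m ∈ A := pow_mem haA m
  refine ⟨Set.ext fun x => ⟨?_, ?_⟩, Set.ext fun x => ⟨?_, ?_⟩⟩
  · rintro ⟨b, hb, rfl⟩
    exact ⟨a ^ m * b, mul_mem ham hb, by rw [pow_succ', mul_assoc]⟩
  · rintro ⟨b, hb, rfl⟩
    refine ⟨r ^ m * b, mul_mem hrm hb, ?_⟩
    rw [← mul_assoc, ← hpow m]
  · rintro ⟨b, hb, rfl⟩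
    exact ⟨b * a ^ m, mul_mem hb ham, by rw [pow_succ, mul_assoc]⟩
  · rintro ⟨b, hb, rfl⟩
    refine ⟨b * r ^ m, mul_mem hb hrm, ?_⟩
    rw [mul_assoc, ← (hcomm.pow_pow (m + 1) m).eq, ← hpow m]
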